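/- Let X and Y be Banach spaces. For a closed subideal I of L(X,Y), let Ψ(I) denote the closed linear span in L(X ⊕ Y) of the set of operators on X ⊕ Y that factor through some element of I, i.e. operators of the form B∘T∘A with T ∈ I, A ∈ L(X ⊕ Y, X) and B ∈ L(Y, X ⊕ Y). Then for any two closed subideals I and J of L(X,Y): Ψ(I) ⊆ Ψ(J) if and only if I ⊆ J. In particular Ψ is an order isomorphism between the closed subideals of L(X,Y) and the closed ideals of L(X ⊕ Y) of the form Ψ(I). -/

import Mathlib

noncomputable section

variable {𝕜 X Y : Type*} [RCLike 𝕜]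
  [NormedAddCommGroup X] [NormedSpace 𝕜 X] [NormedAddCommGroup Y] [NormedSpace 𝕜 Y]

/-- `I` is a closed subideal of `L(X,Y)`: a norm-closed linear subspace such that
`B ∘ T ∘ A ∈ I` whenever `T ∈ I`, `A ∈ L(X)` and `B ∈ L(Y)`. -/
def IsClosedSubideal (I : Submodule 𝕜 (X →L[𝕜] Y)) : Prop :=
  IsClosed (I : Set (X →L[𝕜] Y)) ∧
    ∀ T ∈ I, ∀ A : X →L[𝕜] X, ∀ B : Y →L[𝕜] Y, B.comp (T.comp A) ∈ I

/-- `Ψ(I)`: the closed linear span, inside `L(X ⊕ Y)`, of the operators on `X ⊕ Y`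
factoring through some element of `I`. Here `X ⊕ Y` carries the product
norm `‖(x, y)‖ = max ‖x‖ ‖y‖`. -/
def Psi (I : Submodule 𝕜 (X →L[𝕜] Y)) : Submodule 𝕜 ((X × Y) →L[𝕜] (X × Y)) :=
  (Submodule.span 𝕜 {S : (X × Y) →L[𝕜] (X × Y) |
      ∃ T ∈ I, ∃ A : (X × Y) →L[𝕜] X, ∃ B : Y →L[𝕜] (X × Y),
        S = B.comp (T.comp A)}).topologicalClosure

/-- for closed subideals `I, J` of `L(X,Y)` one has
`Ψ(I) ⊆ Ψ(J)` if and only if `I ⊆ J`; hence `Ψ` is an order isomorphism onto its image. -/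
theorem statement5 [CompleteSpace X] [CompleteSpace Y]
    (I J : Submodule 𝕜 (X →L[𝕜] Y))
    (hI : IsClosedSubideal I) (hJ : IsClosedSubideal J) :
    (Psi I : Set ((X × Y) →L[𝕜] (X × Y))) ⊆ (Psi J : Set ((X × Y) →L[𝕜] (X × Y))) ↔
      (I : Set (X →L[𝕜] Y)) ⊆ (J : Set (X →L[𝕜] Y)) := by
  constructor
  · intro h T hT
    have h1 : (ContinuousLinearMap.inr 𝕜 X Y).comp (T.comp (ContinuousLinearMap.fst 𝕜 X Y)) ∈ Psi I :=
      Submodule.le_topologicalClosure _ (Submodule.subset_span ⟨T, hT, _, _, rfl⟩)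
    have key : ∀ S ∈ Psi J, (ContinuousLinearMap.snd 𝕜 X Y).comp
        (S.comp (ContinuousLinearMap.inl 𝕜 X Y)) ∈ J := by
      intro S hS
      have hcl : IsClosed {S : (X × Y) →L[𝕜] (X × Y) | (ContinuousLinearMap.snd 𝕜 X Y).comp
          (S.comp (ContinuousLinearMap.inl 𝕜 X Y)) ∈ J} :=
        hJ.1.preimage (by fun_prop)
      refine closure_minimal ?_ hcl hS
      intro S hS
      refine Submodule.span_induction ?_ ?_ ?_ ?_ hS
      · rintro _ ⟨T, hT, A, B, rfl⟩
        exact hJ.2 T hT (A.comp (ContinuousLinearMap.inl 𝕜 X Y))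
          ((ContinuousLinearMap.snd 𝕜 X Y).comp B)
      · simp
      · intro S₁ S₂ _ _ h₁ h₂
        simpa [ContinuousLinearMap.add_comp, ContinuousLinearMap.comp_add] using J.add_mem h₁ h₂
      · intro c S _ h
        simpa [ContinuousLinearMap.smul_comp, ContinuousLinearMap.comp_smul] using J.smul_mem c h
    have h2 := key _ (h h1)
    have h3 : (ContinuousLinearMap.snd 𝕜 X Y).comp
        (((ContinuousLinearMap.inr 𝕜 X Y).comp (T.comp (ContinuousLinearMap.fst 𝕜 X Y))).comp
          (ContinuousLinearMap.inl 𝕜 X Y)) = T := by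
      ext x; simp
    rw [h3] at h2
    exact h2
  · intro h
    refine Submodule.topologicalClosure_mono (Submodule.span_mono ?_)
    rintro _ ⟨T, hT, A, B, rfl⟩
    exact ⟨T, h hT, A, B, rfl⟩

end
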